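/- Let (J, Γ) be in standard form at 0 ∈ ℂⁿ, with J defined on a neighborhood U₀ of 0, first-order coefficients L^i_{j̄k}, L^i_{j̄k̄}, and defining function ρ(z) = 2 Re zⁿ − Σ_α|z^α|² + O(|z|³). Set A_{ᾱβ̄} := L^n_{ᾱβ̄}, let J⁰ be the corresponding osculating structure and ρ⁰(z) = 2 Re zⁿ − Σ_α|z^α|². For t > 0 let φ_t(z) = (z¹/t, …, z^{n−1}/t, zⁿ/t²). Then: (i) for every sufficiently small t > 0 the rescaled structure J^t_w := dφ_t ∘ J_{φ_t^{−1}(w)} ∘ dφ_t^{−1} together with the hypersurface φ_t(Γ ∩ U₀) is in standard form at 0, with the same coefficients A_{ᾱβ̄} (so with the same osculating pair (J⁰, Γ⁰)); (ii) for every compact set K ⊂ ℂⁿ, sup_{w∈K} ‖J^t_w − J⁰_w‖ → 0 and sup_{w∈K} |t^{−2}·ρ(φ_t^{−1}(w)) − ρ⁰(w)| → 0 as t → 0⁺ (for t small enough that φ_t^{−1}(K) ⊂ U₀). -/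

import Mathlib

open Complex ComplexConjugate Finset Asymptotics

noncomputable section

/-- Standard complex structure of `ℂⁿ`: multiplication by `i`. -/
def Jstd (n : ℕ) : (Fin n → ℂ) →L[ℝ] (Fin n → ℂ) :=
  Complex.I • ContinuousLinearMap.id ℝ (Fin n → ℂ)

/-- The functional `v ↦ Σ_{α,β} A_{ᾱβ̄} z̄^β conj(v^α)` used in the osculating structure. -/
def oscCoeff (n : ℕ) (A : Fin n → Fin n → ℂ) (z : Fin (n+1) → ℂ) :
    (Fin (n+1) → ℂ) →L[ℝ] ℂ :=
  ∑ α : Fin n, ∑ β : Fin n,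
    (A α β * conj (z β.castSucc)) •
      (Complex.conjCLE.toContinuousLinearMap.comp
        (ContinuousLinearMap.proj α.castSucc : (Fin (n+1) → ℂ) →L[ℝ] ℂ))

/-- The osculating almost complex structure `J⁰` on `ℂ^{n+1}` with coefficients `A`. -/
def Josc (n : ℕ) (A : Fin n → Fin n → ℂ) (z : Fin (n+1) → ℂ) :
    (Fin (n+1) → ℂ) →L[ℝ] (Fin (n+1) → ℂ) :=
  Jstd (n+1) + (oscCoeff n A z).smulRight (Pi.single (Fin.last n) 1)

/-- Diagonal real scaling of `ℂ^{n+1}` with factors `c i`. -/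
def dilCLM (n : ℕ) (c : Fin (n+1) → ℝ) :
    (Fin (n+1) → ℂ) →L[ℝ] (Fin (n+1) → ℂ) :=
  ContinuousLinearMap.pi fun i =>
    c i • (ContinuousLinearMap.proj i : (Fin (n+1) → ℂ) →L[ℝ] ℂ)

/-- Inverse of the anisotropic dilation `φ_t`: `(φ_t)⁻¹(w)` multiplies the first `n`
coordinates by `t` and the last by `t²`. -/
def phiInv (n : ℕ) (t : ℝ) (w : Fin (n+1) → ℂ) : Fin (n+1) → ℂ :=
  fun i => if i = Fin.last n then (t^2 : ℝ) • w i else t • w i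

/-- The rescaled structure `J^t_w := dφ_t ∘ J_{φ_t⁻¹(w)} ∘ dφ_t⁻¹`. -/
def Jt (n : ℕ) (J : (Fin (n+1) → ℂ) → ((Fin (n+1) → ℂ) →L[ℝ] (Fin (n+1) → ℂ)))
    (t : ℝ) (w : Fin (n+1) → ℂ) : (Fin (n+1) → ℂ) →L[ℝ] (Fin (n+1) → ℂ) :=
  (dilCLM n fun i => if i = Fin.last n then (t^2)⁻¹ else t⁻¹).comp
    ((J (phiInv n t w)).comp (dilCLM n fun i => if i = Fin.last n then t^2 else t))

/-- The model defining function `ρ⁰(z) = 2 Re zⁿ − Σ_α |z^α|²`. -/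
def rho0 (n : ℕ) (z : Fin (n+1) → ℂ) : ℝ :=
  2 * (z (Fin.last n)).re - ∑ α : Fin n, Complex.normSq (z α.castSucc)

/-- The weight of the `i`-th coordinate under the anisotropic dilation: `t²` for the last
coordinate and `t` for the others. -/
def dilWeight (n : ℕ) (t : ℝ) (i : Fin (n+1)) : ℝ := if i = Fin.last n then t^2 else t

/-- The scaling factor of the `(i, j, k)` first-order coefficient. -/
def coeffWeight (n : ℕ) (t : ℝ) (i j k : Fin (n+1)) : ℝ :=
  (dilWeight n t i)⁻¹ * dilWeight n t j * dilWeight n t k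

lemma dilWeight_pos (n : ℕ) {t : ℝ} (ht : 0 < t) (i : Fin (n+1)) : 0 < dilWeight n t i := by
  unfold dilWeight; split_ifs <;> positivity

lemma dilWeight_le (n : ℕ) {t : ℝ} (ht : 0 < t) (ht1 : t ≤ 1) (i : Fin (n+1)) :
    dilWeight n t i ≤ t := by
  unfold dilWeight; split_ifs
  · nlinarith
  · exact le_rfl

lemma inv_dilWeight_le (n : ℕ) {t : ℝ} (ht : 0 < t) (ht1 : t ≤ 1) (i : Fin (n+1)) :
    (dilWeight n t i)⁻¹ ≤ (t^2)⁻¹ := by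
  apply inv_anti₀ (by positivity)
  unfold dilWeight; split_ifs
  · exact le_rfl
  · nlinarith

lemma phiInv_apply (n : ℕ) (t : ℝ) (w : Fin (n+1) → ℂ) (i : Fin (n+1)) :
    phiInv n t w i = dilWeight n t i * w i := by
  unfold phiInv dilWeight
  split_ifs <;> simp

lemma phiInv_eq_dilCLM (n : ℕ) (t : ℝ) : phiInv n t = dilCLM n (dilWeight n t) := by
  ext w i
  simp [phiInv_apply, dilCLM]

lemma phiInv_zero (n : ℕ) (t : ℝ) : phiInv n t 0 = 0 := by
  rw [phiInv_eq_dilCLM, map_zero]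

lemma norm_phiInv_le (n : ℕ) {t : ℝ} (ht : 0 < t) (ht1 : t ≤ 1) (w : Fin (n+1) → ℂ) :
    ‖phiInv n t w‖ ≤ t * ‖w‖ := by
  refine (pi_norm_le_iff_of_nonneg (by positivity)).2 fun i => ?_
  rw [phiInv_apply, norm_mul, Complex.norm_real, Real.norm_of_nonneg (dilWeight_pos n ht i).le]
  exact mul_le_mul (dilWeight_le n ht ht1 i) (norm_le_pi_norm w i) (norm_nonneg _) ht.le

lemma Jt_eq (n : ℕ) (J : (Fin (n+1) → ℂ) → ((Fin (n+1) → ℂ) →L[ℝ] (Fin (n+1) → ℂ)))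
    (t : ℝ) (w : Fin (n+1) → ℂ) :
    Jt n J t w = (dilCLM n fun i => (dilWeight n t i)⁻¹).comp
      ((J (phiInv n t w)).comp (dilCLM n (dilWeight n t))) := by
  have h : (fun i : Fin (n+1) => (dilWeight n t i)⁻¹) =
      fun i => if i = Fin.last n then (t^2)⁻¹ else t⁻¹ := by
    funext i; unfold dilWeight; split_ifs <;> rfl
  rw [h]; rfl

lemma Jt_apply (n : ℕ) (J : (Fin (n+1) → ℂ) → ((Fin (n+1) → ℂ) →L[ℝ] (Fin (n+1) → ℂ)))
    (t : ℝ) (w v : Fin (n+1) → ℂ) (i : Fin (n+1)) :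
    Jt n J t w v i = ((dilWeight n t i)⁻¹ : ℝ) * J (phiInv n t w) (phiInv n t v) i := by
  rw [Jt_eq, phiInv_eq_dilCLM]
  simp [dilCLM]

lemma Jt_zero (n : ℕ) {J : (Fin (n+1) → ℂ) → ((Fin (n+1) → ℂ) →L[ℝ] (Fin (n+1) → ℂ))}
    (hJ0 : J 0 = Jstd (n+1)) {t : ℝ} (ht : 0 < t) : Jt n J t 0 = Jstd (n+1) := by
  ext1 v
  ext1 i
  have h : (dilWeight n t i : ℂ) ≠ 0 := by exact_mod_cast (dilWeight_pos n ht i).ne'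
  rw [Jt_apply, phiInv_zero, hJ0]
  simp only [Jstd, smul_apply, ContinuousLinearMap.id_apply, Pi.smul_apply,
    smul_eq_mul, phiInv_apply, ofReal_inv]
  field_simp

lemma fderiv_Jt_apply (n : ℕ)
    {J : (Fin (n+1) → ℂ) → ((Fin (n+1) → ℂ) →L[ℝ] (Fin (n+1) → ℂ))}
    (hJ : DifferentiableAt ℝ J 0) (t : ℝ) (z v : Fin (n+1) → ℂ) (i : Fin (n+1)) :
    fderiv ℝ (Jt n J t) 0 z v i =
      ((dilWeight n t i)⁻¹ : ℝ) * fderiv ℝ J 0 (phiInv n t z) (phiInv n t v) i := by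
  set D := dilCLM n (dilWeight n t)
  set D' := dilCLM n fun i => (dilWeight n t i)⁻¹
  have hJ' : HasFDerivAt J (fderiv ℝ J 0) (D 0) := by simpa using hJ.hasFDerivAt
  have h1 : HasFDerivAt (fun w => J (D w)) ((fderiv ℝ J 0).comp D) 0 :=
    hJ'.comp (0 : Fin (n+1) → ℂ) D.hasFDerivAt
  have h2 := (hasFDerivAt_const D' (0 : Fin (n+1) → ℂ)).clm_comp
    (h1.clm_comp (hasFDerivAt_const D (0 : Fin (n+1) → ℂ)))
  have h3 : Jt n J t = fun w => D'.comp ((J (D w)).comp D) := by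
    funext w; rw [Jt_eq, phiInv_eq_dilCLM]
  rw [h3, h2.fderiv, phiInv_eq_dilCLM]
  simp [D', D, dilCLM]

lemma rho0_phiInv (n : ℕ) (t : ℝ) (w : Fin (n+1) → ℂ) :
    rho0 n (phiInv n t w) = t^2 * rho0 n w := by
  have h : ∀ α : Fin n, α.castSucc ≠ Fin.last n := fun α => α.castSucc_lt_last.ne
  have hl : phiInv n t w (Fin.last n) = (t^2 : ℝ) * w (Fin.last n) := by
    simp [phiInv_apply, dilWeight]
  have hc : ∀ α : Fin n, phiInv n t w α.castSucc = (t : ℝ) * w α.castSucc := fun α => by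
    simp [phiInv_apply, dilWeight, h α]
  simp only [rho0, hl, hc, Complex.re_ofReal_mul, Complex.normSq_mul, Complex.normSq_ofReal,
    ← Finset.mul_sum]
  ring

lemma rescaled_sub_rho0 (n : ℕ) (ρ : (Fin (n+1) → ℂ) → ℝ) {t : ℝ} (ht : 0 < t)
    (w : Fin (n+1) → ℂ) :
    (t^2)⁻¹ * ρ (phiInv n t w) - rho0 n w =
      (t^2)⁻¹ * (ρ (phiInv n t w) - rho0 n (phiInv n t w)) := by
  rw [rho0_phiInv]; field_simp

lemma coeffWeight_last (n : ℕ) {t : ℝ} (ht : 0 < t) (α β : Fin n) :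
    coeffWeight n t (Fin.last n) α.castSucc β.castSucc = 1 := by
  have h : ∀ α : Fin n, α.castSucc ≠ Fin.last n := fun α => α.castSucc_lt_last.ne
  simp only [coeffWeight, dilWeight, h, if_true, if_false]
  field_simp

lemma coeffWeight_pos (n : ℕ) {t : ℝ} (ht : 0 < t) (i j k : Fin (n+1)) :
    0 < coeffWeight n t i j k :=
  mul_pos (mul_pos (inv_pos.2 (dilWeight_pos n ht i)) (dilWeight_pos n ht j))
    (dilWeight_pos n ht k)

lemma coeffWeight_le (n : ℕ) {t : ℝ} (ht : 0 < t) (ht1 : t ≤ 1) (i j k : Fin (n+1))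
    (h : ¬ (i = Fin.last n ∧ j ≠ Fin.last n ∧ k ≠ Fin.last n)) :
    coeffWeight n t i j k ≤ t := by
  have hi := dilWeight_pos n ht i
  rw [coeffWeight, mul_assoc, inv_mul_le_iff₀ hi]
  have hj := dilWeight_le n ht ht1 j
  have hk := dilWeight_le n ht ht1 k
  have hj0 := dilWeight_pos n ht j
  have hk0 := dilWeight_pos n ht k
  by_cases hil : i = Fin.last n
  · have hi' : dilWeight n t i = t^2 := by simp [dilWeight, hil]
    rw [hi']
    by_cases hjl : j = Fin.last n
    · have hj' : dilWeight n t j = t^2 := by simp [dilWeight, hjl]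
      rw [hj']
      exact mul_le_mul_of_nonneg_left hk (by positivity)
    · have hkl : k = Fin.last n := by tauto
      have hk' : dilWeight n t k = t^2 := by simp [dilWeight, hkl]
      rw [hk', mul_comm]
      exact mul_le_mul_of_nonneg_left hj (by positivity)
  · have hi' : dilWeight n t i = t := by simp [dilWeight, hil]
    rw [hi']
    exact mul_le_mul hj hk hk0.le ht.le

/-- A first-order form evaluated at dilated vectors, in terms of the coefficient weights. -/
lemma firstOrder_phiInv (n : ℕ) (t : ℝ) (L1 L2 : Fin (n+1) → Fin (n+1) → Fin (n+1) → ℂ)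
    (z v : Fin (n+1) → ℂ) (i : Fin (n+1)) :
    (((dilWeight n t i)⁻¹ : ℝ) : ℂ) * (∑ j, ∑ k,
        (L1 i j k * phiInv n t z k + L2 i j k * conj (phiInv n t z k)) *
          conj (phiInv n t v j)) =
      ∑ j, ∑ k, (coeffWeight n t i j k * L1 i j k * z k +
        coeffWeight n t i j k * L2 i j k * conj (z k)) * conj (v j) := by
  simp only [Finset.mul_sum, phiInv_apply, map_mul, Complex.conj_ofReal, coeffWeight, ofReal_mul]
  refine Finset.sum_congr rfl fun j _ => Finset.sum_congr rfl fun k _ => ?_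
  ring

/-- The osculating structure as a sum over all first-order coefficients. -/
lemma Josc_apply (n : ℕ) (A : Fin n → Fin n → ℂ)
    (L1 L2 : Fin (n+1) → Fin (n+1) → Fin (n+1) → ℂ)
    (h1 : ∀ α β : Fin n, L1 (Fin.last n) α.castSucc β.castSucc = 0)
    (hA : ∀ α β, A α β = L2 (Fin.last n) α.castSucc β.castSucc)
    (w v : Fin (n+1) → ℂ) (i : Fin (n+1)) :
    Josc n A w v i = Jstd (n+1) v i + ∑ j, ∑ k,
      (if i = Fin.last n ∧ j ≠ Fin.last n ∧ k ≠ Fin.last n then (1 : ℂ) else 0) *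
        ((L1 i j k * w k + L2 i j k * conj (w k)) * conj (v j)) := by
  have h : ∀ α : Fin n, α.castSucc ≠ Fin.last n := fun α => α.castSucc_lt_last.ne
  by_cases hi : i = Fin.last n
  · subst hi
    simp [Josc, oscCoeff, Fin.sum_univ_castSucc, h, h1, hA]
  · simp [Josc, hi]

/-- The rescaled first-order part differs from the osculating term by `O(t)`. -/
lemma norm_firstOrder_sub_le (n : ℕ) {t : ℝ} (ht : 0 < t) (ht1 : t ≤ 1)
    (L1 L2 : Fin (n+1) → Fin (n+1) → Fin (n+1) → ℂ)
    (w v : Fin (n+1) → ℂ) (i : Fin (n+1)) :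
    ‖(∑ j, ∑ k, (coeffWeight n t i j k * L1 i j k * w k +
        coeffWeight n t i j k * L2 i j k * conj (w k)) * conj (v j)) - ∑ j, ∑ k,
      (if i = Fin.last n ∧ j ≠ Fin.last n ∧ k ≠ Fin.last n then (1 : ℂ) else 0) *
        ((L1 i j k * w k + L2 i j k * conj (w k)) * conj (v j))‖ ≤
      t * (∑ i, ∑ j, ∑ k, (‖L1 i j k‖ + ‖L2 i j k‖)) * ‖w‖ * ‖v‖ := by
  have hS : (∑ j, ∑ k, (‖L1 i j k‖ + ‖L2 i j k‖)) ≤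
      ∑ i, ∑ j, ∑ k, (‖L1 i j k‖ + ‖L2 i j k‖) :=
    Finset.single_le_sum (f := fun i => ∑ j, ∑ k, (‖L1 i j k‖ + ‖L2 i j k‖))
      (fun i _ => by positivity) (Finset.mem_univ i)
  have hterm : ∀ j k, ‖(coeffWeight n t i j k * L1 i j k * w k +
        coeffWeight n t i j k * L2 i j k * conj (w k)) * conj (v j) -
      (if i = Fin.last n ∧ j ≠ Fin.last n ∧ k ≠ Fin.last n then (1 : ℂ) else 0) *
        ((L1 i j k * w k + L2 i j k * conj (w k)) * conj (v j))‖ ≤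
      t * (‖L1 i j k‖ + ‖L2 i j k‖) * ‖w‖ * ‖v‖ := by
    intro j k
    split_ifs with hc
    · obtain ⟨rfl, hj, hk⟩ := hc
      obtain ⟨α, rfl⟩ := Fin.exists_castSucc_eq.2 hj
      obtain ⟨β, rfl⟩ := Fin.exists_castSucc_eq.2 hk
      rw [coeffWeight_last n ht]
      simp only [ofReal_one, one_mul, sub_self, norm_zero]
      positivity
    · have e : (coeffWeight n t i j k * L1 i j k * w k +
          coeffWeight n t i j k * L2 i j k * conj (w k)) * conj (v j) -
          0 * ((L1 i j k * w k + L2 i j k * conj (w k)) * conj (v j)) =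
          coeffWeight n t i j k * (L1 i j k * w k + L2 i j k * conj (w k)) * conj (v j) := by
        ring
      rw [e, norm_mul, norm_mul, Complex.norm_real,
        Real.norm_of_nonneg (coeffWeight_pos n ht i j k).le, Complex.norm_conj]
      have hb : ‖L1 i j k * w k + L2 i j k * conj (w k)‖ ≤
          (‖L1 i j k‖ + ‖L2 i j k‖) * ‖w‖ := by
        refine (norm_add_le _ _).trans ?_
        rw [norm_mul, norm_mul, Complex.norm_conj, add_mul]
        gcongr <;> exact norm_le_pi_norm w k
      rw [mul_assoc t]
      exact mul_le_mul (mul_le_mul (coeffWeight_le n ht ht1 i j k hc) hb (norm_nonneg _) ht.le)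
        (norm_le_pi_norm v j) (norm_nonneg _) (by positivity)
  simp only [← Finset.sum_sub_distrib]
  calc _ ≤ ∑ j, ∑ k, t * (‖L1 i j k‖ + ‖L2 i j k‖) * ‖w‖ * ‖v‖ :=
        norm_sum_le_of_le _ fun j _ => norm_sum_le_of_le _ fun k _ => hterm j k
    _ = t * (∑ j, ∑ k, (‖L1 i j k‖ + ‖L2 i j k‖)) * ‖w‖ * ‖v‖ := by
        simp only [Finset.mul_sum, Finset.sum_mul]
    _ ≤ _ := by gcongr

/-- Distance between the rescaled and the osculating structure, in terms of the remainder of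
the first-order expansion of `J`. -/
lemma norm_Jt_sub_Josc_le (n : ℕ)
    {J : (Fin (n+1) → ℂ) → ((Fin (n+1) → ℂ) →L[ℝ] (Fin (n+1) → ℂ))}
    (hJ0 : J 0 = Jstd (n+1)) (L1 L2 : Fin (n+1) → Fin (n+1) → Fin (n+1) → ℂ)
    (hL : ∀ (z v : Fin (n+1) → ℂ) (i : Fin (n+1)),
      fderiv ℝ J 0 z v i =
        ∑ j, ∑ k, (L1 i j k * z k + L2 i j k * conj (z k)) * conj (v j))
    (h1 : ∀ α β : Fin n, L1 (Fin.last n) α.castSucc β.castSucc = 0)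
    (A : Fin n → Fin n → ℂ) (hA : ∀ α β, A α β = L2 (Fin.last n) α.castSucc β.castSucc)
    {t : ℝ} (ht : 0 < t) (ht1 : t ≤ 1) (w : Fin (n+1) → ℂ) :
    ‖Jt n J t w - Josc n A w‖ ≤
      t * (∑ i, ∑ j, ∑ k, (‖L1 i j k‖ + ‖L2 i j k‖)) * ‖w‖ +
        t⁻¹ * ‖J (phiInv n t w) - J 0 - fderiv ℝ J 0 (phiInv n t w)‖ := by
  refine ContinuousLinearMap.opNorm_le_bound _ (by positivity) fun v => ?_
  refine (pi_norm_le_iff_of_nonneg (by positivity)).2 fun i => ?_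
  set E := J (phiInv n t w) - J 0 - fderiv ℝ J 0 (phiInv n t w) with hE
  have hJ : J (phiInv n t w) (phiInv n t v) i = J 0 (phiInv n t v) i +
      fderiv ℝ J 0 (phiInv n t w) (phiInv n t v) i + E (phiInv n t v) i := by
    simp [hE]
  have h0 : (((dilWeight n t i)⁻¹ : ℝ) : ℂ) * J 0 (phiInv n t v) i = Jstd (n+1) v i := by
    have := congrArg (fun T => T v i) (Jt_zero n hJ0 ht)
    simpa only [Jt_apply, phiInv_zero] using this
  have hEb : ‖(((dilWeight n t i)⁻¹ : ℝ) : ℂ) * E (phiInv n t v) i‖ ≤ t⁻¹ * ‖E‖ * ‖v‖ := by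
    rw [norm_mul, Complex.norm_real,
      Real.norm_of_nonneg (inv_nonneg.2 (dilWeight_pos n ht i).le)]
    calc _ ≤ (t^2)⁻¹ * (‖E‖ * (t * ‖v‖)) := by
          refine mul_le_mul (inv_dilWeight_le n ht ht1 i) ?_ (norm_nonneg _) (by positivity)
          refine (norm_le_pi_norm _ i).trans ((E.le_opNorm _).trans ?_)
          gcongr
          exact norm_phiInv_le n ht ht1 v
      _ = _ := by field_simp
  have hsplit : (Jt n J t w - Josc n A w) v i =
      ((∑ j, ∑ k, (coeffWeight n t i j k * L1 i j k * w k +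
        coeffWeight n t i j k * L2 i j k * conj (w k)) * conj (v j)) - ∑ j, ∑ k,
      (if i = Fin.last n ∧ j ≠ Fin.last n ∧ k ≠ Fin.last n then (1 : ℂ) else 0) *
        ((L1 i j k * w k + L2 i j k * conj (w k)) * conj (v j))) +
      (((dilWeight n t i)⁻¹ : ℝ) : ℂ) * E (phiInv n t v) i := by
    rw [sub_apply, Pi.sub_apply, Jt_apply, hJ,
      Josc_apply n A L1 L2 h1 hA, ← firstOrder_phiInv, ← hL, mul_add, mul_add, h0]
    ring
  rw [hsplit, add_mul]
  exact (norm_add_le _ _).trans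
    (add_le_add (norm_firstOrder_sub_le n ht ht1 L1 L2 w v i) hEb)

/-- the anisotropic dilations `φ_t` deform a pair `(J, Γ)` in standard form
into its osculating pair `(J⁰, Γ⁰)`: each rescaled pair is again in standard form with
the same coefficients `A`, and the rescaled structures and defining functions converge
uniformly on compacta to `J⁰` and `ρ⁰` as `t → 0⁺`. -/
theorem stmt9 (n : ℕ) (hn : 1 ≤ n)
    (U₀ : Set (Fin (n+1) → ℂ)) (hUopen : IsOpen U₀) (hU0 : (0 : Fin (n+1) → ℂ) ∈ U₀)
    (J : (Fin (n+1) → ℂ) → ((Fin (n+1) → ℂ) →L[ℝ] (Fin (n+1) → ℂ)))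
    (hJsmooth : ContDiffOn ℝ (⊤ : ℕ∞) J U₀)
    (hJacs : ∀ z ∈ U₀, ∀ v, J z (J z v) = -v)
    (hJ0 : J 0 = Jstd (n+1))
    (L1 L2 : Fin (n+1) → Fin (n+1) → Fin (n+1) → ℂ)
    (hL : ∀ (z v : Fin (n+1) → ℂ) (i : Fin (n+1)),
      fderiv ℝ J 0 z v i =
        ∑ j, ∑ k, (L1 i j k * z k + L2 i j k * conj (z k)) * conj (v j))
    -- (J, Γ) in standard form:
    (hstd1 : ∀ α β : Fin n, L1 (Fin.last n) α.castSucc β.castSucc = 0)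
    (hstd2 : ∀ α β : Fin n,
      L2 (Fin.last n) α.castSucc β.castSucc = - L2 (Fin.last n) β.castSucc α.castSucc)
    (ρ : (Fin (n+1) → ℂ) → ℝ) (hρ : ContDiffOn ℝ (⊤ : ℕ∞) ρ U₀)
    (hρform : (fun z : Fin (n+1) → ℂ => ρ z - rho0 n z) =O[nhds 0]
      fun z : Fin (n+1) → ℂ => ‖z‖ ^ 3)
    -- the coefficients of the osculating pair:
    (A : Fin n → Fin n → ℂ)
    (hA : ∀ α β, A α β = L2 (Fin.last n) α.castSucc β.castSucc) :
    -- (i) the rescaled pairs are in standard form with the same osculating data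
    (∃ ε > (0:ℝ), ∀ t : ℝ, 0 < t → t < ε →
      Jt n J t 0 = Jstd (n+1) ∧
      (∃ L1t L2t : Fin (n+1) → Fin (n+1) → Fin (n+1) → ℂ,
        (∀ (z v : Fin (n+1) → ℂ) (i : Fin (n+1)),
          fderiv ℝ (Jt n J t) 0 z v i =
            ∑ j, ∑ k, (L1t i j k * z k + L2t i j k * conj (z k)) * conj (v j)) ∧
        (∀ α β : Fin n, L1t (Fin.last n) α.castSucc β.castSucc = 0) ∧
        (∀ α β : Fin n, L2t (Fin.last n) α.castSucc β.castSucc = A α β)) ∧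
      ((fun w : Fin (n+1) → ℂ => (t^2)⁻¹ * ρ (phiInv n t w) - rho0 n w) =O[nhds 0]
        fun w : Fin (n+1) → ℂ => ‖w‖ ^ 3)) ∧
    -- (ii) uniform convergence on compacta to the osculating pair
    (∀ K : Set (Fin (n+1) → ℂ), IsCompact K → ∀ ε' > (0:ℝ),
      ∃ δ > (0:ℝ), ∀ t : ℝ, 0 < t → t < δ →
        (∀ w ∈ K, phiInv n t w ∈ U₀) ∧
        (∀ w ∈ K, ‖Jt n J t w - Josc n A w‖ ≤ ε') ∧
        (∀ w ∈ K, |(t^2)⁻¹ * ρ (phiInv n t w) - rho0 n w| ≤ ε')) := by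
  have hnhds : U₀ ∈ nhds (0 : Fin (n+1) → ℂ) := hUopen.mem_nhds hU0
  have hJd : DifferentiableAt ℝ J 0 :=
    (hJsmooth.contDiffAt hnhds).differentiableAt (by simp)
  refine ⟨⟨1, one_pos, fun t ht _ => ⟨Jt_zero n hJ0 ht, ?_, ?_⟩⟩, ?_⟩
  · refine ⟨fun i j k => coeffWeight n t i j k * L1 i j k,
      fun i j k => coeffWeight n t i j k * L2 i j k, fun z v i => ?_, fun α β => ?_,
      fun α β => ?_⟩
    · rw [fderiv_Jt_apply n hJd, hL, firstOrder_phiInv]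
    · simp [hstd1]
    · simp [coeffWeight_last n ht, hA]
  · have hcont : Filter.Tendsto (phiInv n t) (nhds 0) (nhds 0) := by
      have h := (dilCLM n (dilWeight n t)).continuous.tendsto 0
      rwa [map_zero, ← phiInv_eq_dilCLM] at h
    have hlin : phiInv n t =O[nhds 0] fun w : Fin (n+1) → ℂ => w := by
      rw [phiInv_eq_dilCLM]
      exact (dilCLM n (dilWeight n t)).isBigO_id _
    have hcomp := (hρform.comp_tendsto hcont).trans (hlin.norm_norm.pow 3)
    refine (hcomp.const_mul_left (t^2)⁻¹).congr_left fun w => ?_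
    exact (rescaled_sub_rho0 n ρ ht w).symm
  · intro K hK ε hε
    obtain ⟨R, hR, hKR⟩ := hK.isBounded.exists_pos_norm_le
    obtain ⟨C, hC, hCρ⟩ := hρform.exists_pos
    have hE : ∀ᶠ z in nhds (0 : Fin (n+1) → ℂ),
        ‖J z - J 0 - fderiv ℝ J 0 z‖ ≤ ε / (2 * R) * ‖z‖ := by
      have := hJd.hasFDerivAt.isLittleO.def (c := ε / (2 * R)) (by positivity)
      simpa using this
    obtain ⟨r, hr, hball⟩ := Metric.eventually_nhds_iff.1
      ((Filter.eventually_of_mem hnhds fun _ h => h).and (hE.and hCρ.bound))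
    set S := ∑ i, ∑ j, ∑ k, (‖L1 i j k‖ + ‖L2 i j k‖)
    have hS : 0 ≤ S := by positivity
    have hsmall : ∀ M : ℝ, ∀ r > 0, ∀ᶠ t in nhds (0 : ℝ), t * M < r := fun M r hr => by
      have h : Filter.Tendsto (fun t : ℝ => t * M) (nhds 0) (nhds 0) := by
        simpa using (continuous_id.mul continuous_const).tendsto (0 : ℝ) (f := fun t : ℝ => t * M)
      exact h.eventually_lt_const hr
    obtain ⟨δ, hδ, hδt⟩ := Metric.eventually_nhds_iff.1
      ((hsmall 1 1 one_pos).and ((hsmall R r hr).and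
        ((hsmall (S * R) (ε / 2) (by positivity)).and (hsmall (C * R^3) ε hε))))
    refine ⟨δ, hδ, fun t ht htδ => ?_⟩
    obtain ⟨ht1, htr, htS, htC⟩ := hδt (y := t) (by simpa [abs_of_pos ht] using htδ)
    rw [mul_one] at ht1
    have hφ : ∀ w ∈ K, ‖phiInv n t w‖ ≤ t * R := fun w hw =>
      (norm_phiInv_le n ht ht1.le w).trans (by gcongr; exact hKR w hw)
    have hb : ∀ w ∈ K, _ := fun w hw =>
      hball (y := phiInv n t w) (by simpa using (hφ w hw).trans_lt htr)
    refine ⟨fun w hw => (hb w hw).1, fun w hw => ?_, fun w hw => ?_⟩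
    · refine (norm_Jt_sub_Josc_le n hJ0 L1 L2 hL hstd1 A hA ht ht1.le w).trans ?_
      have hfirst : t * S * ‖w‖ ≤ ε / 2 := by
        calc t * S * ‖w‖ ≤ t * S * R := by gcongr; exact hKR w hw
          _ ≤ ε / 2 := by linarith
      have hsecond : t⁻¹ * ‖J (phiInv n t w) - J 0 - fderiv ℝ J 0 (phiInv n t w)‖ ≤ ε / 2 := by
        calc _ ≤ t⁻¹ * (ε / (2 * R) * (t * R)) := by
              gcongr
              refine (hb w hw).2.1.trans ?_
              gcongr
              exact hφ w hw
          _ = ε / 2 := by field_simp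
      linarith
    · have hρw := (hb w hw).2.2
      rw [Real.norm_eq_abs, norm_pow, norm_norm] at hρw
      rw [rescaled_sub_rho0 n ρ ht, abs_mul, abs_of_pos (by positivity : 0 < (t^2)⁻¹)]
      calc _ ≤ (t^2)⁻¹ * (C * (t * R)^3) := by
            gcongr
            refine hρw.trans ?_
            gcongr
            exact hφ w hw
        _ = t * (C * R^3) := by field_simp
        _ ≤ ε := htC.le
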